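/- Fix integers a, b with b > (n−1)a > 0. Then for every bipartition λ = (λ^(1)|λ^(2)) of n, Lusztig's a-invariant is given by the closed formula a_λ = b·|λ^(2)| + a·(n(λ^(1)) + 2·n(λ^(2)) − n(λ^(2)*)). -/

import Mathlib

open Finset

/-- `f : ℕ → ℕ` is the 0-indexed part function of a partition: `f i` is the part
`λ_{i+1}`; the sequence is weakly decreasing and eventually zero. -/
def IsPartitionFun (f : ℕ → ℕ) : Prop := Antitone f ∧ ∃ M, f M = 0

/-- The size `|λ|` of the partition with part function `f`. -/
noncomputable def psize (f : ℕ → ℕ) : ℕ := ∑' i, f i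

/-- `α_i = a·(λ^{(1)}_{N+r-i+1} + i - 1) + b'` for `1 ≤ i ≤ N + r`,
where `f` is the 0-indexed part function of `λ^{(1)}`. -/
def alphaE (a b' r N : ℕ) (f : ℕ → ℕ) (i : ℕ) : ℕ := a * (f (N + r - i) + (i - 1)) + b'

/-- `β_j = a·(λ^{(2)}_{N-j+1} + j - 1)` for `1 ≤ j ≤ N`,
where `g` is the 0-indexed part function of `λ^{(2)}`. -/
def betaE (a N : ℕ) (g : ℕ → ℕ) (j : ℕ) : ℕ := a * (g (N - j) + (j - 1))

/-- `A_N(λ) = Σ_{1≤i≤N+r, 1≤j≤N} min(α_i, β_j) + Σ_{1≤i<j≤N+r} min(α_i, α_j)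
    + Σ_{1≤i<j≤N} min(β_i, β_j)`. -/
def AE (a b' r N : ℕ) (f g : ℕ → ℕ) : ℕ :=
  (∑ i ∈ Icc 1 (N + r), ∑ j ∈ Icc 1 N, min (alphaE a b' r N f i) (betaE a N g j)) +
  (∑ i ∈ Icc 1 (N + r), ∑ j ∈ Icc (i + 1) (N + r),
      min (alphaE a b' r N f i) (alphaE a b' r N f j)) +
  (∑ i ∈ Icc 1 N, ∑ j ∈ Icc (i + 1) N, min (betaE a N g i) (betaE a N g j))

/-- `B_N = Σ_{1≤i≤N+r, 1≤j≤N} min(a(i-1)+b', a(j-1))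
    + Σ_{1≤i<j≤N+r} min(a(i-1)+b', a(j-1)+b') + Σ_{1≤i<j≤N} min(a(i-1), a(j-1))`. -/
def BE (a b' r N : ℕ) : ℕ :=
  (∑ i ∈ Icc 1 (N + r), ∑ j ∈ Icc 1 N, min (a * (i - 1) + b') (a * (j - 1))) +
  (∑ i ∈ Icc 1 (N + r), ∑ j ∈ Icc (i + 1) (N + r),
      min (a * (i - 1) + b') (a * (j - 1) + b')) +
  (∑ i ∈ Icc 1 N, ∑ j ∈ Icc (i + 1) N, min (a * (i - 1)) (a * (j - 1)))

/-- `N` is admissible for the bipartition `(f | g)`: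
`λ^{(1)}_{N+r+1} = 0` and `λ^{(2)}_{N+1} = 0`. -/
def AdmissibleN (r N : ℕ) (f g : ℕ → ℕ) : Prop := f (N + r) = 0 ∧ g N = 0

/-- `n(ν) = Σ_{i≥1} (i-1)·ν_i` for the partition with 0-indexed part function `f`. -/
noncomputable def nFn (f : ℕ → ℕ) : ℕ := ∑' i, i * f i

/-- The 0-indexed part function of the conjugate partition: `ν*_{i+1} = #{j : ν_j ≥ i+1}`. -/
noncomputable def conjFn (f : ℕ → ℕ) (i : ℕ) : ℕ := Set.ncard {j : ℕ | i + 1 ≤ f j}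

theorem IsPartitionFun.apply_eq_zero {f : ℕ → ℕ} (hf : IsPartitionFun f) {M i : ℕ}
    (hM : f M = 0) (hi : M ≤ i) : f i = 0 :=
  Nat.le_zero.mp (hM ▸ hf.1 hi)

theorem IsPartitionFun.psize_eq_sum {f : ℕ → ℕ} (hf : IsPartitionFun f) {M : ℕ}
    (hM : f M = 0) : psize f = ∑ i ∈ range M, f i :=
  tsum_eq_sum fun i hi => hf.apply_eq_zero hM (by simpa using hi)

theorem IsPartitionFun.nFn_eq_sum {f : ℕ → ℕ} (hf : IsPartitionFun f) {M : ℕ}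
    (hM : f M = 0) : nFn f = ∑ i ∈ range M, i * f i :=
  tsum_eq_sum fun i hi => by rw [hf.apply_eq_zero hM (by simpa using hi), mul_zero]

theorem IsPartitionFun.apply_le_psize {f : ℕ → ℕ} (hf : IsPartitionFun f) (k : ℕ) :
    f k ≤ psize f := by
  obtain ⟨M, hM⟩ := hf.2
  by_cases hk : k < M
  · rw [hf.psize_eq_sum hM]
    exact single_le_sum (f := f) (fun _ _ => Nat.zero_le _) (mem_range.mpr hk)
  · simp [hf.apply_eq_zero hM (not_lt.mp hk)]

theorem IsPartitionFun.lt_psize {f : ℕ → ℕ} (hf : IsPartitionFun f) {k : ℕ}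
    (hk : 0 < f k) : k < psize f := by
  obtain ⟨M, hM⟩ := hf.2
  have hkM : k < M := by
    by_contra h
    exact hk.ne' (hf.apply_eq_zero hM (not_lt.mp h))
  rw [hf.psize_eq_sum hM]
  calc k < ∑ _i ∈ range (k + 1), 1 := by simp
    _ ≤ ∑ i ∈ range (k + 1), f i :=
      sum_le_sum fun i hi => hk.trans_le (hf.1 (Nat.lt_succ_iff.mp (mem_range.mp hi)))
    _ ≤ ∑ i ∈ range M, f i :=
      sum_le_sum_of_subset (range_subset_range.mpr hkM)

theorem IsPartitionFun.conjFn_eq_sum {f : ℕ → ℕ} (hf : IsPartitionFun f) {M : ℕ}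
    (hM : f M = 0) (i : ℕ) : conjFn f i = ∑ l ∈ range M, if i < f l then 1 else 0 := by
  have h : {j : ℕ | i + 1 ≤ f j} = ((range M).filter fun l => i < f l : Finset ℕ) := by
    ext j
    simp only [Set.mem_ofPred_eq, coe_filter, mem_range]
    refine ⟨fun hj => ⟨?_, hj⟩, fun hj => hj.2⟩
    by_contra hMj
    have := hf.apply_eq_zero hM (not_lt.mp hMj)
    omega
  rw [conjFn, h, Set.ncard_coe_finset, card_filter]

/-- `n(ν*) = Σ_i (ν_i choose 2)`. -/
theorem IsPartitionFun.nFn_conjFn {f : ℕ → ℕ} (hf : IsPartitionFun f) {M : ℕ}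
    (hM : f M = 0) : nFn (conjFn f) = ∑ l ∈ range M, ∑ i ∈ range (f l), i := by
  have h : nFn (conjFn f) = ∑ i ∈ range (f 0), i * conjFn f i := by
    refine tsum_eq_sum fun i hi => ?_
    rw [hf.conjFn_eq_sum hM, sum_eq_zero, mul_zero]
    intro l _
    have := hf.1 (Nat.zero_le l)
    rw [if_neg]
    simp only [mem_range] at hi
    omega
  simp_rw [h, hf.conjFn_eq_sum hM, mul_sum]
  rw [sum_comm]
  refine sum_congr rfl fun l _ => ?_
  have hl := hf.1 (Nat.zero_le l)
  simp only [mul_ite, mul_one, mul_zero]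
  rw [← sum_filter]
  refine sum_congr ?_ fun _ _ => rfl
  ext i
  simp only [mem_filter, mem_range]
  omega

theorem sum_Icc_one_eq_sum_range_reflect {R : Type*} [AddCommMonoid R] (M : ℕ) (φ : ℕ → R) :
    ∑ i ∈ Icc 1 M, φ i = ∑ k ∈ range M, φ (M - k) := by
  refine sum_bij' (fun i _ => M - i) (fun k _ => M - k) ?_ ?_ ?_ ?_ ?_
  all_goals intro i hi
  all_goals simp only [mem_Icc, mem_range] at hi ⊢
  on_goal 5 => congr 1
  all_goals omega

theorem betaE_eq_alphaE (a N : ℕ) (g : ℕ → ℕ) : betaE a N g = alphaE a 0 0 N g := by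
  ext j
  simp [betaE, alphaE]

theorem BE_eq_AE_zero (a b' r N : ℕ) : BE a b' r N = AE a b' r N 0 0 := by
  simp [BE, AE, alphaE, betaE]

theorem alphaE_sub (a b' r N : ℕ) (f : ℕ → ℕ) {k : ℕ} (hk : k < N + r) :
    alphaE a b' r N f (N + r - k) = a * (f k + (N + r - 1 - k)) + b' := by
  rw [alphaE, show N + r - (N + r - k) = k by omega, show N + r - k - 1 = N + r - 1 - k by omega]

theorem alphaE_le_alphaE (a b' r N : ℕ) {f : ℕ → ℕ} (hf : Antitone f) {i j : ℕ} (hij : i ≤ j) :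
    alphaE a b' r N f i ≤ alphaE a b' r N f j := by
  have : f (N + r - i) ≤ f (N + r - j) := hf (by omega)
  unfold alphaE
  gcongr

theorem sum_min_alphaE (a b' r N : ℕ) {f : ℕ → ℕ} (hf : Antitone f) :
    ∑ i ∈ Icc 1 (N + r), ∑ j ∈ Icc (i + 1) (N + r),
        min (alphaE a b' r N f i) (alphaE a b' r N f j) =
      ∑ k ∈ range (N + r), k * (a * (f k + (N + r - 1 - k)) + b') := by
  rw [sum_Icc_one_eq_sum_range_reflect]
  refine sum_congr rfl fun k hk => ?_
  rw [mem_range] at hk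
  rw [← alphaE_sub a b' r N f hk, sum_congr rfl fun j hj => min_eq_left
    (alphaE_le_alphaE a b' r N hf ((Nat.le_succ _).trans (mem_Icc.mp hj).1))]
  rw [sum_const, Nat.card_Icc, smul_eq_mul]
  congr 1
  omega

theorem sum_min_alphaE_eq_add (a b' r N : ℕ) {f : ℕ → ℕ} (hf : Antitone f) :
    ∑ i ∈ Icc 1 (N + r), ∑ j ∈ Icc (i + 1) (N + r),
        min (alphaE a b' r N f i) (alphaE a b' r N f j) =
      ∑ i ∈ Icc 1 (N + r), ∑ j ∈ Icc (i + 1) (N + r),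
        min (alphaE a b' r N 0 i) (alphaE a b' r N 0 j) +
      a * ∑ k ∈ range (N + r), k * f k := by
  rw [sum_min_alphaE a b' r N hf, sum_min_alphaE a b' r N (f := 0) antitone_const, mul_sum,
    ← sum_add_distrib]
  refine sum_congr rfl fun k _ => ?_
  simp only [Pi.zero_apply]
  ring

theorem min_mul_add_succ {a c : ℕ} (hc : c < a) (u v : ℕ) :
    min (a * u + c) (a * (v + 1)) =
      min (a * u + c) (a * v) + ((if v < u then a else 0) + if v = u then c else 0) := by
  rcases lt_trichotomy v u with h | rfl | h
  · have : a * (v + 1) ≤ a * u := Nat.mul_le_mul_left a h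
    rw [if_pos h, if_neg h.ne, min_eq_right (by omega), min_eq_right (by grind)]
    ring
  · simp only [lt_irrefl, if_false, if_true, mul_add, mul_one]
    rw [min_eq_left (by omega), min_eq_right (by omega)]
    omega
  · have : a * (u + 1) ≤ a * v := Nat.mul_le_mul_left a h
    rw [if_neg h.not_gt, if_neg h.ne', min_eq_left (by grind), min_eq_left (by grind), add_zero,
      add_zero]

theorem sum_min_succ {a b' r N l m : ℕ} (hb' : b' < a) (hl : l < N) (hm : m ≤ r + l) :
    ∑ k ∈ range (N + r), min (a * (N + r - 1 - k) + b') (a * (m + 1 + (N - 1 - l))) =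
      ∑ k ∈ range (N + r), min (a * (N + r - 1 - k) + b') (a * (m + (N - 1 - l))) +
        (a * (r + l - m) + b') := by
  have h : ∀ k ∈ range (N + r),
      min (a * (N + r - 1 - k) + b') (a * (m + 1 + (N - 1 - l))) =
        min (a * (N + r - 1 - k) + b') (a * (m + (N - 1 - l))) +
          ((if k < r + l - m then a else 0) + if k = r + l - m then b' else 0) := by
    intro k hk
    rw [mem_range] at hk
    rw [show m + 1 + (N - 1 - l) = m + (N - 1 - l) + 1 by omega, min_mul_add_succ hb']
    congr 3 <;> simp only [eq_iff_iff] <;> omega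
  have hfilter : (range (N + r)).filter (· < r + l - m) = range (r + l - m) := by
    ext k
    simp only [mem_filter, mem_range]
    omega
  rw [sum_congr rfl h, sum_add_distrib, sum_add_distrib, ← sum_filter, hfilter, sum_const,
    card_range, sum_ite_eq', if_pos (mem_range.mpr (by omega)), smul_eq_mul,
    mul_comm (r + l - m)]

theorem sum_min_eq_add {a b' r N l m : ℕ} (hb' : b' < a) (hl : l < N) (hm : m ≤ r + l + 1) :
    ∑ k ∈ range (N + r), min (a * (N + r - 1 - k) + b') (a * (m + (N - 1 - l))) +
        a * ∑ i ∈ range m, i =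
      ∑ k ∈ range (N + r), min (a * (N + r - 1 - k) + b') (a * (N - 1 - l)) +
        ((a * r + b') * m + a * (l * m)) := by
  induction m with
  | zero => simp
  | succ m ih =>
    have := ih (by omega)
    obtain ⟨d, hd⟩ := Nat.exists_eq_add_of_le (show m ≤ r + l by omega)
    rw [sum_min_succ hb' hl (by omega), sum_range_succ, show r + l - m = d by omega]
    have hd' : a * (r + l) = a * (m + d) := by rw [hd]
    linarith

theorem sum_min_alphaE_betaE {a b' r N : ℕ} (f g : ℕ → ℕ) :
    ∑ i ∈ Icc 1 (N + r), ∑ j ∈ Icc 1 N, min (alphaE a b' r N f i) (betaE a N g j) =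
      ∑ l ∈ range N, ∑ k ∈ range (N + r),
        min (a * (f k + (N + r - 1 - k)) + b') (a * (g l + (N - 1 - l))) := by
  rw [sum_comm, sum_Icc_one_eq_sum_range_reflect]
  refine sum_congr rfl fun l hl => ?_
  rw [sum_Icc_one_eq_sum_range_reflect]
  refine sum_congr rfl fun k hk => ?_
  rw [mem_range] at hk hl
  rw [alphaE_sub a b' r N f hk, betaE_eq_alphaE]
  exact congrArg _ (alphaE_sub a 0 0 N g hl)

theorem sum_min_alphaE_betaE_eq_add {a b' r N : ℕ} (hb' : b' < a) {f g : ℕ → ℕ}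
    (hf : IsPartitionFun f) (hg : IsPartitionFun g) (hr : psize f + psize g ≤ r + 1) :
    ∑ i ∈ Icc 1 (N + r), ∑ j ∈ Icc 1 N, min (alphaE a b' r N f i) (betaE a N g j) +
        a * ∑ l ∈ range N, ∑ i ∈ range (g l), i =
      ∑ i ∈ Icc 1 (N + r), ∑ j ∈ Icc 1 N, min (alphaE a b' r N 0 i) (betaE a N 0 j) +
        ((a * r + b') * ∑ l ∈ range N, g l + a * ∑ l ∈ range N, l * g l) := by
  simp only [sum_min_alphaE_betaE, mul_sum, ← sum_add_distrib, Pi.zero_apply, zero_add]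
  refine sum_congr rfl fun l hl => ?_
  rw [mem_range] at hl
  have hgl := hg.apply_le_psize l
  rw [← sum_min_eq_add hb' hl (by omega), mul_sum]
  congr 1
  refine sum_congr rfl fun k hk => ?_
  rw [mem_range] at hk
  rcases Nat.eq_zero_or_pos (f k) with h0 | hpos
  · rw [h0, zero_add]
  · have := hf.lt_psize hpos
    have h1 : a * (g l + (N - 1 - l)) ≤ a * (N + r - 1 - k) :=
      Nat.mul_le_mul_left a (by omega)
    rw [min_eq_right (by grind), min_eq_right (by omega)]

/-- For `b > (n-1)·a > 0`, Lusztig's `a`-invariant of a bipartition `λ = (f | g)` of `n`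
is given by the closed formula
`a_λ = b·|λ^{(2)}| + a·(n(λ^{(1)}) + 2·n(λ^{(2)}) - n(λ^{(2)*}))`. -/
theorem lusztig_a_invariant_closed_formula
    (n a b r b' : ℕ) (hna : 0 < (n - 1) * a) (hab : (n - 1) * a < b)
    (hb : b = a * r + b') (hb' : b' < a)
    (f g : ℕ → ℕ) (hf : IsPartitionFun f) (hg : IsPartitionFun g)
    (hn : psize f + psize g = n) :
    ∀ N : ℕ, AdmissibleN r N f g →
      (AE a b' r N f g : ℤ) - (BE a b' r N : ℤ) =
        (b : ℤ) * (psize g : ℤ) +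
          (a : ℤ) * ((nFn f : ℤ) + 2 * (nFn g : ℤ) - (nFn (conjFn g) : ℤ)) := by
  rintro N ⟨hfN, hgN⟩
  have hr : psize f + psize g ≤ r + 1 := by
    by_contra h
    have : a * (r + 1) ≤ (n - 1) * a := by
      rw [mul_comm a]
      exact Nat.mul_le_mul_right a (by omega)
    rw [mul_add, mul_one] at this
    omega
  have hcross := sum_min_alphaE_betaE_eq_add (N := N) hb' hf hg hr
  have hα := sum_min_alphaE_eq_add a b' r N hf.1
  have hβ := sum_min_alphaE_eq_add a 0 0 N hg.1
  simp only [← betaE_eq_alphaE, add_zero] at hβ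
  rw [← hg.psize_eq_sum hgN, ← hg.nFn_eq_sum hgN, ← hg.nFn_conjFn hgN, ← hb] at hcross
  rw [← hf.nFn_eq_sum hfN] at hα
  rw [← hg.nFn_eq_sum hgN] at hβ
  rw [BE_eq_AE_zero]
  unfold AE
  zify at hcross hα hβ ⊢
  linarith
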